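/- The geometric number operator N̂^(r) = a^(s)†∘a^(s), with a^(s) = a + b and a^(s)† = a† − b, satisfies N̂^(r) = a†∘a − (ℏ/2mω)u² − (i/ω)·ŵ^(cl), as an identity of operators applied to every smooth f : ℝ → ℂ (where (ℏ/2mω)u² denotes the corresponding multiplication operator). -/

import Mathlib

noncomputable section
open Complex

/-- Operators acting on functions `ℝ → ℂ`. -/
abbrev Op : Type := (ℝ → ℂ) → (ℝ → ℂ)

/-- Multiplication operator by a real-valued function. -/
def mulOp (g : ℝ → ℝ) : Op := fun f x => (g x : ℂ) * f x

/-- Quantum Poisson bracket `[A,B]_QPB = A∘B − B∘A`. -/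
def QPB (A B : Op) : Op := fun f => A (B f) - B (A f)

/-- Quantum covariant Poisson bracket
`[A,B] = [A,B]_QPB + A∘[s,B]_QPB − B∘[s,A]_QPB`. -/
def QCPB (s : ℝ → ℝ) (A B : Op) : Op :=
  fun f => QPB A B f + A (QPB (mulOp s) B f) - B (QPB (mulOp s) A f)

/-- Position (multiplication by `x`). -/
def xhat : Op := fun f x => (x : ℂ) * f x

/-- Classical momentum operator `p̂⁽ᶜˡ⁾ f = −iℏ f'`. -/
def pcl (ℏ : ℝ) : Op := fun f x => -Complex.I * (ℏ : ℂ) * deriv f x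

/-- Classical harmonic-oscillator Hamiltonian. -/
def Hcl (ℏ m ω : ℝ) : Op := fun f x =>
  -((ℏ : ℂ) ^ 2 / (2 * (m : ℂ))) * deriv (deriv f) x
    + ((m : ℂ) * (ω : ℂ) ^ 2 / 2) * (x : ℂ) ^ 2 * f x

/-- Geomentum operator `p̂⁽ʳⁱ⁾ f = −iℏ (f' + u f)` with `u = s'`. -/
def pri (ℏ : ℝ) (s : ℝ → ℝ) : Op := fun f x =>
  -Complex.I * (ℏ : ℂ) * (deriv f x + ((deriv s x : ℝ) : ℂ) * f x)

/-- Ri-operator Hamiltonian `Ĥ⁽ʳⁱ⁾ = (1/2m) p̂⁽ʳⁱ⁾∘p̂⁽ʳⁱ⁾ + (mω²/2)x²`. -/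
def Hri (ℏ m ω : ℝ) (s : ℝ → ℝ) : Op := fun f x =>
  (1 / (2 * (m : ℂ))) * pri ℏ s (pri ℏ s f) x
    + ((m : ℂ) * (ω : ℂ) ^ 2 / 2) * (x : ℂ) ^ 2 * f x

/-- G-dynamics operator `ŵ⁽ᶜˡ⁾ f = −(iℏ/2m)(2u f' + u' f)`. -/
def wcl (ℏ m : ℝ) (s : ℝ → ℝ) : Op := fun f x =>
  -(Complex.I * (ℏ : ℂ) / (2 * (m : ℂ))) *
    (2 * ((deriv s x : ℝ) : ℂ) * deriv f x + ((deriv (deriv s) x : ℝ) : ℂ) * f x)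

/-- Ri G-dynamics operator `ŵ⁽ʳⁱ⁾ f = −(iℏ/2m)(2u f' + u' f + 2u² f)`. -/
def wri (ℏ m : ℝ) (s : ℝ → ℝ) : Op := fun f x =>
  -(Complex.I * (ℏ : ℂ) / (2 * (m : ℂ))) *
    (2 * ((deriv s x : ℝ) : ℂ) * deriv f x + ((deriv (deriv s) x : ℝ) : ℂ) * f x
      + 2 * ((deriv s x : ℝ) : ℂ) ^ 2 * f x)

/-- Annihilation operator. -/
def aOp (ℏ m ω : ℝ) : Op := fun f x =>
  (Real.sqrt (m * ω / (2 * ℏ)) : ℂ) *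
    ((x : ℂ) * f x + ((ℏ : ℂ) / ((m : ℂ) * (ω : ℂ))) * deriv f x)

/-- Creation operator. -/
def adOp (ℏ m ω : ℝ) : Op := fun f x =>
  (Real.sqrt (m * ω / (2 * ℏ)) : ℂ) *
    ((x : ℂ) * f x - ((ℏ : ℂ) / ((m : ℂ) * (ω : ℂ))) * deriv f x)

/-- `b`: multiplication by `√(ℏ/2mω)·u`. -/
def bOp (ℏ m ω : ℝ) (s : ℝ → ℝ) : Op :=
  mulOp (fun x => Real.sqrt (ℏ / (2 * m * ω)) * deriv s x)

/-- Number operator `N̂ = a†∘a`. -/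
def NOp (ℏ m ω : ℝ) : Op := fun f => adOp ℏ m ω (aOp ℏ m ω f)

/-- `N̂⁽ᶜᵍ⁾ = −(i/ω)·ŵ⁽ᶜˡ⁾`. -/
def Ncg (ℏ m ω : ℝ) (s : ℝ → ℝ) : Op := fun f x =>
  -(Complex.I / (ω : ℂ)) * wcl ℏ m s f x

/-- Geometric annihilation operator `a⁽ˢ⁾ = a + b`. -/
def asOp (ℏ m ω : ℝ) (s : ℝ → ℝ) : Op := fun f x =>
  aOp ℏ m ω f x + bOp ℏ m ω s f x

/-- Geometric creation operator `a⁽ˢ⁾† = a† − b`. -/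
def adsOp (ℏ m ω : ℝ) (s : ℝ → ℝ) : Op := fun f x =>
  adOp ℏ m ω f x - bOp ℏ m ω s f x

/-- Leibniz rule for the product of a real-valued and a complex-valued function. -/
theorem HasDerivAt.ofReal_mul_complex {g : ℝ → ℝ} {f : ℝ → ℂ} {g' : ℝ} {f' : ℂ} {x : ℝ}
    (hg : HasDerivAt g g' x) (hf : HasDerivAt f f' x) :
    HasDerivAt (fun y => (g y : ℂ) * f y) ((g' : ℂ) * f x + (g x : ℂ) * f') x :=
  hg.ofReal_comp.mul hf

theorem mulOp_differentiable {g : ℝ → ℝ} {f : ℝ → ℂ} (hg : Differentiable ℝ g)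
    (hf : Differentiable ℝ f) : Differentiable ℝ (mulOp g f) := fun x =>
  ((hg x).hasDerivAt.ofReal_mul_complex (hf x).hasDerivAt).differentiableAt

theorem aOp_differentiable (ℏ m ω : ℝ) {f : ℝ → ℂ} (hf : Differentiable ℝ f)
    (hf' : Differentiable ℝ (deriv f)) : Differentiable ℝ (aOp ℏ m ω f) :=
  ((mulOp_differentiable differentiable_id hf).add (hf'.const_mul _)).const_mul _

/-- The creation operator is additive on differentiable functions. -/
theorem adOp_add (ℏ m ω : ℝ) {f g : ℝ → ℂ} {x : ℝ} (hf : DifferentiableAt ℝ f x)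
    (hg : DifferentiableAt ℝ g x) :
    adOp ℏ m ω (fun y => f y + g y) x = adOp ℏ m ω f x + adOp ℏ m ω g x := by
  simp only [adOp, deriv_fun_add hf hg]
  ring

theorem sqrt_mul_sqrt_eq_half {ℏ m ω : ℝ} (hℏ : 0 < ℏ) (hm : 0 < m) (hω : 0 < ω) :
    Real.sqrt (m * ω / (2 * ℏ)) * Real.sqrt (ℏ / (2 * m * ω)) = 1 / 2 := by
  rw [← Real.sqrt_mul (by positivity), Real.sqrt_eq_iff_mul_self_eq (by positivity) (by norm_num)]
  field_simp

/-- The geometric number operator `N̂⁽ʳ⁾ = a⁽ˢ⁾†∘a⁽ˢ⁾` satisfies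
`N̂⁽ʳ⁾ = a†∘a − (ℏ/2mω)u² − (i/ω)·ŵ⁽ᶜˡ⁾`. -/
theorem geometric_number_operator (ℏ m ω : ℝ)
    (hℏ : 0 < ℏ) (hm : 0 < m) (hω : 0 < ω)
    (s : ℝ → ℝ) (hs : ContDiff ℝ (⊤ : ℕ∞) s) :
    ∀ f : ℝ → ℂ, ContDiff ℝ (⊤ : ℕ∞) f → ∀ x : ℝ,
      adsOp ℏ m ω s (asOp ℏ m ω s f) x
        = adOp ℏ m ω (aOp ℏ m ω f) x
          - ((ℏ : ℂ) / (2 * (m : ℂ) * (ω : ℂ))) * ((deriv s x : ℝ) : ℂ) ^ 2 * f x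
          - (Complex.I / (ω : ℂ)) * wcl ℏ m s f x := by
  intro f hf x
  have hf₀ : Differentiable ℝ f := hf.differentiable (by simp)
  have hf₁ : Differentiable ℝ (deriv f) :=
    (contDiff_infty_iff_deriv.mp hf).2.differentiable (by simp)
  have hu : Differentiable ℝ (deriv s) :=
    (contDiff_infty_iff_deriv.mp hs).2.differentiable (by simp)
  set β := Real.sqrt (ℏ / (2 * m * ω)) with hβ
  have hadd : adOp ℏ m ω (asOp ℏ m ω s f) x
      = adOp ℏ m ω (aOp ℏ m ω f) x + adOp ℏ m ω (bOp ℏ m ω s f) x :=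
    adOp_add ℏ m ω (aOp_differentiable ℏ m ω hf₀ hf₁ x)
      (mulOp_differentiable (hu.const_mul β) hf₀ x)
  have hb : deriv (bOp ℏ m ω s f) x
      = ((β * deriv (deriv s) x : ℝ) : ℂ) * f x + ((β * deriv s x : ℝ) : ℂ) * deriv f x :=
    (((hu x).hasDerivAt.const_mul β).ofReal_mul_complex (hf₀ x).hasDerivAt).deriv
  have hαβ : (Real.sqrt (m * ω / (2 * ℏ)) : ℂ) * (β : ℂ) = 1 / 2 := by
    simpa using congrArg Complex.ofReal (sqrt_mul_sqrt_eq_half hℏ hm hω)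
  have hββ : (β : ℂ) * (β : ℂ) = (ℏ : ℂ) / (2 * (m : ℂ) * (ω : ℂ)) := by
    simpa using congrArg Complex.ofReal
      (Real.mul_self_sqrt (show 0 ≤ ℏ / (2 * m * ω) by positivity))
  have hw : (Complex.I / (ω : ℂ)) * wcl ℏ m s f x = (ℏ : ℂ) / (m : ℂ) / (ω : ℂ) * (1 / 2) *
      (2 * ((deriv s x : ℝ) : ℂ) * deriv f x + ((deriv (deriv s) x : ℝ) : ℂ) * f x) := by
    simp only [wcl]
    linear_combination (-((ℏ : ℂ) / (2 * (m : ℂ)) / (ω : ℂ)) *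
      (2 * ((deriv s x : ℝ) : ℂ) * deriv f x + ((deriv (deriv s) x : ℝ) : ℂ) * f x)) *
      Complex.I_mul_I
  rw [hw, ← hαβ, ← hββ]
  change adOp ℏ m ω (asOp ℏ m ω s f) x - bOp ℏ m ω s (asOp ℏ m ω s f) x = _
  rw [hadd]
  have had : adOp ℏ m ω (bOp ℏ m ω s f) x = (Real.sqrt (m * ω / (2 * ℏ)) : ℂ) *
      ((x : ℂ) * bOp ℏ m ω s f x
        - ((ℏ : ℂ) / ((m : ℂ) * (ω : ℂ))) * deriv (bOp ℏ m ω s f) x) := rfl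
  rw [had, hb]
  simp only [asOp, bOp, mulOp, ← hβ, aOp]
  push_cast
  ring
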